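/- arXiv:2005.11166 — 2 statements merged into one kernel-verified Lean document; each statement's English description precedes it below -/
import Mathlib

section
/- For every n ≥ 1 and every x ∈ ℤ_p, the n-th power of the Volterra operator applied to the constant function 1 satisfies (Ĩⁿ 1)(x) = ((1−p)/(p·log p))ⁿ · (∏_{m=0}^{n−1} d_m) · ‖x‖ⁿ, where d_m = (1 − p^{-1}) (log p) p^{-(m+1)} (1 − p^{-(m+1)})^{-2}. Consequently the coefficients ρ_n = ((1−p)/(p·log p))ⁿ ∏_{m=0}^{n−1} d_m satisfy |ρ_n| ≤ Cⁿ p^{-n(n−1)/2} for some constant C > 0 independent of n. -/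
open MeasureTheory Complex

noncomputable section

variable (p : ℕ) [Fact p.Prime] [MeasurableSpace ℚ_[p]] [BorelSpace ℚ_[p]]

/-- The Volterra operator `Ĩ`:
`(Ĩu)(x) = ((1-p)/(p·log p)) ∫_{‖y‖<‖x‖} (log‖x‖ - log‖y‖) u(y) dμ(y)`. -/
def Ivol (μ : Measure ℚ_[p]) (u : ℚ_[p] → ℂ) (x : ℚ_[p]) : ℂ :=
  (((1 - (p : ℝ)) / ((p : ℝ) * Real.log p) : ℝ) : ℂ) *
    ∫ y in {y : ℚ_[p] | ‖y‖ < ‖x‖},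
      ((Real.log ‖x‖ - Real.log ‖y‖ : ℝ) : ℂ) * u y ∂μ

/-- The constant `d_m = (1 − p^{-1})(log p) p^{-(m+1)} (1 − p^{-(m+1)})^{-2}`. -/
def dCoef (m : ℕ) : ℝ :=
  (1 - (p : ℝ)⁻¹) * Real.log p * (p : ℝ) ^ (-((m : ℤ) + 1)) *
    ((1 - (p : ℝ) ^ (-((m : ℤ) + 1)))⁻¹) ^ 2

/-- The coefficient `ρ_n = ((1−p)/(p·log p))ⁿ ∏_{m=0}^{n−1} d_m`. -/
def rhoCoef (n : ℕ) : ℝ :=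
  ((1 - (p : ℝ)) / ((p : ℝ) * Real.log p)) ^ n * ∏ m ∈ Finset.range n, dCoef p m

lemma exists_natCast_mul_zpow_norm_sub_le {p : ℕ} [Fact p.Prime] {k : ℤ} {y : ℚ_[p]}
    (hy : ‖y‖ ≤ (p : ℝ) ^ k) :
    ∃ i < p, ‖y - i * (p : ℚ_[p]) ^ (-k)‖ ≤ (p : ℝ) ^ (k - 1) := by
  have hp : (0 : ℝ) < p := by exact_mod_cast (Fact.out : p.Prime).pos
  have hpQ : (p : ℚ_[p]) ≠ 0 := by exact_mod_cast (Fact.out : p.Prime).ne_zero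
  have hz : ‖y * (p : ℚ_[p]) ^ k‖ ≤ 1 := by
    rw [norm_mul, Padic.norm_p_zpow, zpow_neg]
    exact mul_inv_le_one_of_le₀ hy (by positivity)
  let z : ℤ_[p] := ⟨y * (p : ℚ_[p]) ^ k, hz⟩
  refine ⟨z.zmodRepr, z.zmodRepr_lt_p, ?_⟩
  have hlt : ‖y * (p : ℚ_[p]) ^ k - z.zmodRepr‖ < (p : ℝ) ^ (0 : ℤ) := by
    rw [zpow_zero]
    exact z.norm_sub_zmodRepr_lt_one
  rw [Padic.norm_lt_pow_iff_norm_le_pow_sub_one] at hlt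
  have hfac : y - z.zmodRepr * (p : ℚ_[p]) ^ (-k) =
      (y * (p : ℚ_[p]) ^ k - z.zmodRepr) * (p : ℚ_[p]) ^ (-k) := by
    rw [sub_mul, mul_assoc, ← zpow_add₀ hpQ]; simp
  rw [hfac, norm_mul, Padic.norm_p_zpow, neg_neg, sub_eq_add_neg k 1, zpow_add₀ hp.ne', mul_comm]
  gcongr
  simpa using hlt

lemma closedBall_zpow_eq_iUnion {p : ℕ} [Fact p.Prime] (k : ℤ) :
    Metric.closedBall (0 : ℚ_[p]) ((p : ℝ) ^ k) =
      ⋃ i : Fin p, Metric.closedBall ((i : ℕ) * (p : ℚ_[p]) ^ (-k)) ((p : ℝ) ^ (k - 1)) := by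
  have hp : (1 : ℝ) ≤ p := by exact_mod_cast (Fact.out : p.Prime).one_le
  ext y
  simp only [Metric.mem_closedBall, dist_eq_norm, sub_zero, Set.mem_iUnion]
  constructor
  · intro hy
    obtain ⟨i, hi, h⟩ := exists_natCast_mul_zpow_norm_sub_le hy
    exact ⟨⟨i, hi⟩, h⟩
  · rintro ⟨i, h⟩
    have hle : (p : ℝ) ^ (k - 1) ≤ (p : ℝ) ^ k := zpow_le_zpow_right₀ hp (by lia)
    have hi : ‖((i : ℕ) : ℚ_[p]) * (p : ℚ_[p]) ^ (-k)‖ ≤ (p : ℝ) ^ k := by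
      rw [norm_mul, Padic.norm_p_zpow, neg_neg]
      exact mul_le_of_le_one_left (by positivity) (by simpa using Padic.norm_int_le_one (p := p) i)
    calc ‖y‖ = ‖(y - (i : ℕ) * (p : ℚ_[p]) ^ (-k)) + (i : ℕ) * (p : ℚ_[p]) ^ (-k)‖ := by
          rw [sub_add_cancel]
      _ ≤ _ := (Padic.nonarchimedean _ _).trans (max_le (h.trans hle) hi)

lemma pairwise_disjoint_closedBall_zpow {p : ℕ} [Fact p.Prime] (k : ℤ) :
    Pairwise (Function.onFun Disjoint fun i : Fin p =>
      Metric.closedBall ((i : ℕ) * (p : ℚ_[p]) ^ (-k)) ((p : ℝ) ^ (k - 1))) := by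
  have hp : (1 : ℝ) < p := by exact_mod_cast (Fact.out : p.Prime).one_lt
  have hp0 : (0 : ℝ) < p := by linarith
  intro i j hij
  rw [Function.onFun, Set.disjoint_left]
  intro y hi hj
  simp only [Metric.mem_closedBall, dist_eq_norm] at hi hj
  have h1 : ‖(((i : ℤ) - (j : ℤ) : ℤ) : ℚ_[p]) * (p : ℚ_[p]) ^ (-k)‖ ≤ (p : ℝ) ^ (k - 1) := by
    have h := (Padic.nonarchimedean (y - ((j : ℕ) : ℚ_[p]) * (p : ℚ_[p]) ^ (-k))
      (-(y - ((i : ℕ) : ℚ_[p]) * (p : ℚ_[p]) ^ (-k)))).trans (max_le hj (by rwa [norm_neg]))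
    have hsub : (((i : ℤ) - (j : ℤ) : ℤ) : ℚ_[p]) * (p : ℚ_[p]) ^ (-k) =
        y - ((j : ℕ) : ℚ_[p]) * (p : ℚ_[p]) ^ (-k) +
          -(y - ((i : ℕ) : ℚ_[p]) * (p : ℚ_[p]) ^ (-k)) := by
      push_cast
      ring
    rwa [hsub]
  rw [norm_mul, Padic.norm_p_zpow, neg_neg] at h1
  have h2 : ‖(((i : ℤ) - (j : ℤ) : ℤ) : ℚ_[p])‖ < 1 := by
    refine lt_of_mul_lt_mul_right (h1.trans_lt ?_) (zpow_pos hp0 k).le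
    rw [one_mul]
    exact zpow_lt_zpow_right₀ hp (by lia)
  rw [Padic.norm_intCast_lt_one_iff] at h2
  refine hij (Fin.ext ?_)
  have := Int.eq_zero_of_abs_lt_dvd h2 (by rw [abs_lt]; omega)
  omega

section Measure

variable {p : ℕ} [Fact p.Prime] [MeasurableSpace ℚ_[p]] [BorelSpace ℚ_[p]]
  (μ : Measure ℚ_[p]) [μ.IsAddHaarMeasure]

lemma measureReal_closedBall_zpow_eq_mul (k : ℤ) :
    μ.real (Metric.closedBall 0 ((p : ℝ) ^ k)) =
      p * μ.real (Metric.closedBall 0 ((p : ℝ) ^ (k - 1))) := by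
  rw [closedBall_zpow_eq_iUnion,
    measureReal_iUnion_fintype (pairwise_disjoint_closedBall_zpow k)
      (fun _ => Metric.isClosed_closedBall.measurableSet)
      (fun _ => (isCompact_closedBall _ _).measure_ne_top)]
  have (c : ℚ_[p]) : μ.real (Metric.closedBall c ((p : ℝ) ^ (k - 1))) =
      μ.real (Metric.closedBall 0 ((p : ℝ) ^ (k - 1))) := by
    simp only [measureReal_def]
    rw [← measure_preimage_add μ c (Metric.closedBall c _)]
    congr 2
    ext; simp [dist_eq_norm]
  simp [this]

variable {μ}

lemma measureReal_closedBall_zpow (hμ : μ {x : ℚ_[p] | ‖x‖ ≤ 1} = 1) (k : ℤ) :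
    μ.real (Metric.closedBall 0 ((p : ℝ) ^ k)) = (p : ℝ) ^ k := by
  have hp : (p : ℝ) ≠ 0 := by exact_mod_cast (Fact.out : p.Prime).ne_zero
  induction k using Int.induction_on with
  | zero =>
    have : Metric.closedBall (0 : ℚ_[p]) 1 = {x | ‖x‖ ≤ 1} := by ext; simp
    simp [measureReal_def, this, hμ]
  | succ n ih =>
    rw [measureReal_closedBall_zpow_eq_mul, add_sub_cancel_right, ih, zpow_add_one₀ hp, mul_comm]
  | pred n ih =>
    rw [measureReal_closedBall_zpow_eq_mul] at ih
    rwa [zpow_sub_one₀ hp, eq_mul_inv_iff_mul_eq₀ hp, mul_comm, ← zpow_sub_one₀ hp]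

lemma measureReal_sphere_zpow (hμ : μ {x : ℚ_[p] | ‖x‖ ≤ 1} = 1) (k : ℤ) :
    μ.real {y : ℚ_[p] | ‖y‖ = (p : ℝ) ^ k} = (p : ℝ) ^ k * (1 - (p : ℝ)⁻¹) := by
  have hp : (p : ℝ) ≠ 0 := by exact_mod_cast (Fact.out : p.Prime).ne_zero
  have hp1 : (1 : ℝ) ≤ p := by exact_mod_cast (Fact.out : p.Prime).one_le
  have hS : {y : ℚ_[p] | ‖y‖ = (p : ℝ) ^ k} =
      Metric.closedBall 0 ((p : ℝ) ^ k) \ Metric.closedBall 0 ((p : ℝ) ^ (k - 1)) := by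
    ext y
    simp only [Set.mem_ofPred_eq, Set.mem_sdiff, mem_closedBall_zero_iff,
      ← Padic.norm_lt_pow_iff_norm_le_pow_sub_one, not_lt]
    exact le_antisymm_iff
  rw [hS, measureReal_sdiff
    (Metric.closedBall_subset_closedBall (zpow_le_zpow_right₀ hp1 (by lia)))
    Metric.isClosed_closedBall.measurableSet (isCompact_closedBall _ _).measure_ne_top,
    measureReal_closedBall_zpow hμ, measureReal_closedBall_zpow hμ, zpow_sub_one₀ hp]
  ring

lemma setIntegral_norm_lt_zpow (hμ : μ {x : ℚ_[p] | ‖x‖ ≤ 1} = 1) (a : ℤ) (g : ℝ → ℝ) {s : ℝ}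
    (hs : HasSum (fun n : ℕ => (p : ℝ) ^ (a - (n + 1)) * (1 - (p : ℝ)⁻¹) *
      g ((p : ℝ) ^ (a - (n + 1)))) s) :
    ∫ y in {y : ℚ_[p] | ‖y‖ < (p : ℝ) ^ a}, g ‖y‖ ∂μ = s := by
  have hp1 : (1 : ℝ) < p := by exact_mod_cast (Fact.out : p.Prime).one_lt
  let S (n : ℕ) : Set ℚ_[p] := {y | ‖y‖ = (p : ℝ) ^ (a - (n + 1))}
  have hSm (n : ℕ) : MeasurableSet (S n) :=
    (isClosed_eq continuous_norm continuous_const).measurableSet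
  have hSfin (n : ℕ) : μ (S n) ≠ ⊤ := by
    refine measure_ne_top_of_subset ?_
      (isCompact_closedBall 0 ((p : ℝ) ^ (a - (n + 1)))).measure_ne_top
    intro y hy
    simpa using (hy : ‖y‖ = _).le
  have hSd : Pairwise (Function.onFun Disjoint S) := by
    intro i j hij
    rw [Function.onFun, Set.disjoint_left]
    intro y hi hj
    have := zpow_right_injective₀ (by linarith) hp1.ne' ((hi : ‖y‖ = _).symm.trans hj)
    lia
  have hU : ⋃ n, S n = {y : ℚ_[p] | ‖y‖ < (p : ℝ) ^ a} \ {0} := by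
    ext y
    simp only [S, Set.mem_iUnion, Set.mem_ofPred_eq, Set.mem_sdiff, Set.mem_singleton_iff]
    constructor
    · rintro ⟨n, hn⟩
      refine ⟨hn ▸ zpow_lt_zpow_right₀ hp1 (by lia), ?_⟩
      rw [← ne_eq, ← norm_pos_iff, hn]
      positivity
    · rintro ⟨h, h0⟩
      rw [Padic.norm_eq_zpow_neg_valuation h0] at h ⊢
      have := (zpow_lt_zpow_iff_right₀ hp1).1 h
      refine ⟨(a + y.valuation - 1).toNat, ?_⟩
      congr 1
      lia
  have hconst (f : ℝ → ℝ) (n : ℕ) : ∫ y in S n, f ‖y‖ ∂μ =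
      (p : ℝ) ^ (a - (n + 1)) * (1 - (p : ℝ)⁻¹) * f ((p : ℝ) ^ (a - (n + 1))) := by
    rw [setIntegral_congr_fun (g := fun _ => f ((p : ℝ) ^ (a - (n + 1)))) (hSm n)
      (fun y hy => congrArg f hy), setIntegral_const, measureReal_sphere_zpow hμ, smul_eq_mul]
  have hint : IntegrableOn (fun y : ℚ_[p] => g ‖y‖) (⋃ n, S n) μ := by
    refine integrableOn_iUnion_of_summable_integral_norm (fun n => ?_) ?_
    · exact (integrableOn_const (hSfin n)).congr_fun
        (fun y hy => (congrArg g hy).symm) (hSm n)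
    · refine hs.summable.norm.congr fun n => ?_
      have hpos : 0 ≤ 1 - (p : ℝ)⁻¹ := sub_nonneg.2 (inv_le_one_of_one_le₀ hp1.le)
      rw [hconst (fun t => ‖g t‖) n, norm_mul, Real.norm_of_nonneg (by positivity)]
  rw [← setIntegral_congr_set (sdiff_null_ae_eq_self (measure_singleton (0 : ℚ_[p]))), ← hU]
  refine (hasSum_integral_iUnion hSm hSd hint).unique ?_
  simpa only [hconst] using hs

lemma setIntegral_log_sub_log_mul_norm_pow (hμ : μ {x : ℚ_[p] | ‖x‖ ≤ 1} = 1) (b : ℝ) (m : ℕ)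
    (x : ℚ_[p]) :
    ∫ y in {y : ℚ_[p] | ‖y‖ < ‖x‖}, (Real.log ‖x‖ - Real.log ‖y‖) * (b * ‖y‖ ^ m) ∂μ =
      b * dCoef p m * ‖x‖ ^ (m + 1) := by
  have hp1 : (1 : ℝ) < p := by exact_mod_cast (Fact.out : p.Prime).one_lt
  have hp0 : (p : ℝ) ≠ 0 := by linarith
  rcases eq_or_ne x 0 with rfl | hx
  · have : {y : ℚ_[p] | ‖y‖ < 0} = ∅ := by
      ext y; simp
    simp [this]
  obtain ⟨a, ha⟩ : ∃ a : ℤ, ‖x‖ = (p : ℝ) ^ a := ⟨_, Padic.norm_eq_zpow_neg_valuation hx⟩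
  rw [ha]
  refine setIntegral_norm_lt_zpow hμ a
    (fun t => (Real.log ((p : ℝ) ^ a) - Real.log t) * (b * t ^ m)) ?_
  set r : ℝ := (p : ℝ) ^ (-((m : ℤ) + 1)) with hr
  have hr0 : 0 < r := by positivity
  have hr1 : r < 1 := zpow_lt_one_of_neg₀ hp1 (by lia)
  have hgeom : HasSum (fun n : ℕ => ((n + 1 : ℕ) : ℝ) * r ^ (n + 1)) (r / (1 - r) ^ 2) := by
    rw [hasSum_nat_add_iff (f := fun n : ℕ => (n : ℝ) * r ^ n) 1]
    simpa using hasSum_coe_mul_geometric_of_norm_lt_one (𝕜 := ℝ)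
      (by rwa [Real.norm_of_nonneg hr0.le])
  convert! hgeom.mul_left (b * (1 - (p : ℝ)⁻¹) * Real.log p * ((p : ℝ) ^ a) ^ (m + 1)) using 1
  · ext n
    have hpow : (p : ℝ) ^ (a - (n + 1)) * ((p : ℝ) ^ (a - (n + 1))) ^ m =
        ((p : ℝ) ^ a) ^ (m + 1) * r ^ (n + 1) := by
      simp only [hr, ← zpow_natCast, ← zpow_mul, ← zpow_add₀ hp0]
      congr 1
      push_cast
      ring
    rw [Real.log_zpow, Real.log_zpow]
    push_cast
    linear_combination ((n : ℝ) + 1) * Real.log p * b * (1 - (p : ℝ)⁻¹) * hpow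
  · simp only [dCoef, ← hr, inv_pow, div_eq_mul_inv]
    ring

lemma Ivol_ofReal_mul_norm_pow (hμ : μ {x : ℚ_[p] | ‖x‖ ≤ 1} = 1) (b : ℝ) (m : ℕ) :
    Ivol p μ (fun y => ((b * ‖y‖ ^ m : ℝ) : ℂ)) = fun x =>
      (((1 - (p : ℝ)) / ((p : ℝ) * Real.log p) * (b * dCoef p m) * ‖x‖ ^ (m + 1) : ℝ) : ℂ) := by
  ext x
  simp only [Ivol, ← ofReal_mul]
  rw [integral_complex_ofReal, setIntegral_log_sub_log_mul_norm_pow hμ, ← ofReal_mul]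
  congr 1
  ring

lemma Ivol_iterate_one (hμ : μ {x : ℚ_[p] | ‖x‖ ≤ 1} = 1) (n : ℕ) :
    (Ivol p μ)^[n] (fun _ => 1) = fun x => ((rhoCoef p n * ‖x‖ ^ n : ℝ) : ℂ) := by
  induction n with
  | zero => simp [rhoCoef]
  | succ n ih =>
    rw [Function.iterate_succ_apply', ih, Ivol_ofReal_mul_norm_pow hμ]
    ext x
    congr 2
    rw [rhoCoef, rhoCoef, Finset.prod_range_succ]
    ring

end Measure

lemma abs_mul_dCoef_le (p : ℕ) [Fact p.Prime] (m : ℕ) :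
    |(1 - (p : ℝ)) / ((p : ℝ) * Real.log p) * dCoef p m| ≤ (p : ℝ) ^ (-(m : ℝ)) := by
  have hp1 : (1 : ℝ) < p := by exact_mod_cast (Fact.out : p.Prime).one_lt
  have hp0 : (0 : ℝ) < p := by linarith
  have hlog : Real.log p ≠ 0 := (Real.log_pos hp1).ne'
  set r : ℝ := (p : ℝ) ^ (-((m : ℤ) + 1)) with hr
  have hr0 : 0 < r := by positivity
  have hrp : r ≤ (p : ℝ)⁻¹ := by
    rw [hr, ← zpow_neg_one]
    exact zpow_le_zpow_right₀ hp1.le (by lia)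
  have hpinv : (p : ℝ)⁻¹ < 1 := inv_lt_one_of_one_lt₀ hp1
  have heq : (1 - (p : ℝ)) / ((p : ℝ) * Real.log p) * dCoef p m =
      -(((1 - (p : ℝ)⁻¹) / (1 - r)) ^ 2 * r) := by
    simp only [dCoef, ← hr]
    have : 1 - r ≠ 0 := by linarith
    field_simp
    ring
  rw [heq, abs_neg, abs_of_nonneg (by positivity)]
  have hq : ((1 - (p : ℝ)⁻¹) / (1 - r)) ^ 2 ≤ 1 :=
    pow_le_one₀ (div_nonneg (by linarith) (by linarith))
      ((div_le_one (by linarith)).2 (by linarith))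
  refine (mul_le_of_le_one_left hr0.le hq).trans ?_
  rw [hr, ← Real.rpow_intCast]
  exact Real.rpow_le_rpow_of_exponent_le hp1.le (by push_cast; linarith)

lemma abs_rhoCoef_le (p : ℕ) [Fact p.Prime] (n : ℕ) :
    |rhoCoef p n| ≤ (p : ℝ) ^ (-((n : ℝ) * ((n : ℝ) - 1) / 2)) := by
  have hp0 : (0 : ℝ) < p := by exact_mod_cast (Fact.out : p.Prime).pos
  induction n with
  | zero => simp [rhoCoef]
  | succ n ih =>
    have hsucc : rhoCoef p (n + 1) = rhoCoef p n *
        ((1 - (p : ℝ)) / ((p : ℝ) * Real.log p) * dCoef p n) := by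
      rw [rhoCoef, rhoCoef, Finset.prod_range_succ]
      ring
    rw [hsucc, abs_mul]
    refine (mul_le_mul ih (abs_mul_dCoef_le p n) (abs_nonneg _) (by positivity)).trans_eq ?_
    rw [← Real.rpow_add hp0]
    congr 1
    push_cast
    ring

/-- For every `n ≥ 1` and every `x ∈ ℤ_p`,
`(Ĩⁿ1)(x) = ((1−p)/(p·log p))ⁿ (∏_{m=0}^{n−1} d_m) ‖x‖ⁿ`, and the coefficients
`ρ_n = ((1−p)/(p·log p))ⁿ ∏_{m<n} d_m` satisfy `|ρ_n| ≤ Cⁿ p^{-n(n−1)/2}` for a constant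
`C > 0` independent of `n`. -/
theorem statement12
    (μ : Measure ℚ_[p]) [μ.IsAddHaarMeasure]
    (hμ : μ {x : ℚ_[p] | ‖x‖ ≤ 1} = 1) :
    (∀ n : ℕ, 1 ≤ n → ∀ x : ℚ_[p], ‖x‖ ≤ 1 →
      (Ivol p μ)^[n] (fun _ => 1) x = ((rhoCoef p n : ℝ) : ℂ) * ((‖x‖ ^ n : ℝ) : ℂ)) ∧
    (∃ C : ℝ, 0 < C ∧ ∀ n : ℕ, 1 ≤ n →
      |rhoCoef p n| ≤ C ^ n * (p : ℝ) ^ (-((n : ℝ) * ((n : ℝ) - 1) / 2))) := by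
  refine ⟨fun n _ x _ => ?_, 1, one_pos, fun n _ => ?_⟩
  · simp only [Ivol_iterate_one hμ, ofReal_mul]
  · simpa using abs_rhoCoef_le p n
end
end

section
/- There exist a constant C > 0 and complex numbers σ_n, η_n (n ≥ 1) with |σ_n| ≤ Cⁿ p^{-n(n−1)/2} and |η_n| ≤ Cⁿ p^{-n(n−1)/2}, such that for every n ≥ 1 and every x ∈ ℤ_p with x ≠ 0, the n-th power of the Volterra operator applied to the function x ↦ log‖x‖ satisfies (Ĩⁿ log‖·‖)(x) = σ_n ‖x‖ⁿ log‖x‖ + η_n ‖x‖ⁿ. -/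
open MeasureTheory Complex

section Padic

variable {p : ℕ} [Fact p.Prime]

theorem Padic.exists_lt_norm_sub_natCast_mul_le (m : ℤ) (x : ℚ_[p])
    (hx : ‖x‖ ≤ (p : ℝ) ^ (m + 1)) :
    ∃ a < p, ‖x - a * (p : ℚ_[p]) ^ (-(m + 1))‖ ≤ (p : ℝ) ^ m := by
  have hp : (0 : ℝ) < p := mod_cast (Fact.out : p.Prime).pos
  have hp' : (p : ℚ_[p]) ≠ 0 := mod_cast (Fact.out : p.Prime).ne_zero
  have hz : ‖x * (p : ℚ_[p]) ^ (m + 1)‖ ≤ 1 := by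
    rw [norm_mul, Padic.norm_p_zpow, zpow_neg]
    exact mul_inv_le_one_of_le₀ hx (by positivity)
  let z : ℤ_[p] := ⟨x * (p : ℚ_[p]) ^ (m + 1), hz⟩
  refine ⟨z.zmodRepr, z.zmodRepr_lt_p, ?_⟩
  have h : ‖x * (p : ℚ_[p]) ^ (m + 1) - z.zmodRepr‖ < 1 := by
    have h := z.norm_sub_zmodRepr_lt_one
    rwa [PadicInt.norm_def, PadicInt.coe_sub, PadicInt.coe_natCast] at h
  rw [Padic.norm_le_pow_iff_norm_lt_pow_add_one]
  have e : x - z.zmodRepr * (p : ℚ_[p]) ^ (-(m + 1))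
      = (x * (p : ℚ_[p]) ^ (m + 1) - z.zmodRepr) * (p : ℚ_[p]) ^ (-(m + 1)) := by
    rw [sub_mul, mul_assoc, ← zpow_add₀ hp']
    rw [add_neg_cancel, zpow_zero, mul_one]
  rw [e, norm_mul, Padic.norm_p_zpow, neg_neg]
  exact mul_lt_of_lt_one_left (by positivity) h

theorem Padic.natCast_eq_of_norm_sub_mul_le (m : ℤ) (x : ℚ_[p]) {a b : ℕ} (ha : a < p)
    (hb : b < p) (hxa : ‖x - a * (p : ℚ_[p]) ^ (-(m + 1))‖ ≤ (p : ℝ) ^ m)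
    (hxb : ‖x - b * (p : ℚ_[p]) ^ (-(m + 1))‖ ≤ (p : ℝ) ^ m) : a = b := by
  have hp : (0 : ℝ) < p := mod_cast (Fact.out : p.Prime).pos
  have h : ‖(((b : ℤ) - a : ℤ) : ℚ_[p]) * (p : ℚ_[p]) ^ (-(m + 1))‖ ≤ (p : ℝ) ^ m := by
    have e : (((b : ℤ) - a : ℤ) : ℚ_[p]) * (p : ℚ_[p]) ^ (-(m + 1))
        = (x - a * (p : ℚ_[p]) ^ (-(m + 1))) - (x - b * (p : ℚ_[p]) ^ (-(m + 1))) := by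
      push_cast
      ring
    rw [e]
    rw [sub_eq_add_neg]
    exact (Padic.nonarchimedean _ _).trans (max_le hxa (by rwa [norm_neg]))
  rw [Padic.norm_le_pow_iff_norm_lt_pow_add_one, norm_mul, Padic.norm_p_zpow, neg_neg,
    mul_lt_iff_lt_one_left (by positivity), Padic.norm_intCast_lt_one_iff] at h
  have := Int.eq_zero_of_abs_lt_dvd h (by rw [abs_lt]; omega)
  omega

end Padic

section Series

/-- The series `∑_{k ≥ 1} k ^ j * Q ^ k`. -/
noncomputable def powGeomSum (j : ℕ) (Q : ℝ) : ℝ := ∑' k : ℕ, ((k : ℝ) + 1) ^ j * Q ^ (k + 1)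

theorem hasSum_powGeomSum (j : ℕ) {Q : ℝ} (h0 : 0 ≤ Q) (h1 : Q < 1) :
    HasSum (fun k : ℕ => ((k : ℝ) + 1) ^ j * Q ^ (k + 1)) (powGeomSum j Q) := by
  have h := summable_pow_mul_geometric_of_norm_lt_one (R := ℝ) j
    (r := Q) (by rwa [Real.norm_of_nonneg h0])
  have h' := (summable_nat_add_iff 1).2 h
  push_cast at h'
  exact h'.hasSum

theorem powGeomSum_nonneg (j : ℕ) {Q : ℝ} (h0 : 0 ≤ Q) : 0 ≤ powGeomSum j Q :=
  tsum_nonneg fun k => by positivity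

theorem powGeomSum_one_le_two {Q : ℝ} (h0 : 0 ≤ Q) (h1 : Q < 1) :
    powGeomSum 1 Q ≤ powGeomSum 2 Q := by
  refine hasSum_le (fun k => ?_) (hasSum_powGeomSum 1 h0 h1) (hasSum_powGeomSum 2 h0 h1)
  gcongr
  · linarith [k.cast_nonneg (α := ℝ)]
  · norm_num

theorem powGeomSum_le (j : ℕ) {Q : ℝ} (h0 : 0 ≤ Q) (h1 : Q ≤ 1 / 2) :
    powGeomSum j Q ≤ 2 * powGeomSum j (1 / 2) * Q := by
  refine hasSum_le (fun k => ?_) (hasSum_powGeomSum j h0 (by linarith))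
    (((hasSum_powGeomSum j (Q := 1 / 2) (by norm_num) (by norm_num)).mul_left 2).mul_right Q)
  calc ((k : ℝ) + 1) ^ j * Q ^ (k + 1) = ((k : ℝ) + 1) ^ j * Q ^ k * Q := by ring
    _ ≤ ((k : ℝ) + 1) ^ j * (1 / 2) ^ k * Q := by gcongr
    _ = 2 * (((k : ℝ) + 1) ^ j * (1 / 2) ^ (k + 1)) * Q := by ring

/-- The coefficients `(σ_n, η_n)` in `Ĩⁿ log‖·‖ = σ_n ‖·‖ⁿ log‖·‖ + η_n ‖·‖ⁿ`. -/
noncomputable def volterraCoeff (p : ℕ) : ℕ → ℝ × ℝ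
  | 0 => (1, 0)
  | n + 1 =>
    let Q : ℝ := ((p : ℝ) ^ (n + 1))⁻¹
    let a := volterraCoeff p n
    (-(1 - (p : ℝ)⁻¹) ^ 2 * (powGeomSum 1 Q * a.1),
      -(1 - (p : ℝ)⁻¹) ^ 2 * (powGeomSum 1 Q * a.2 - Real.log p * powGeomSum 2 Q * a.1))

theorem volterraCoeff_bound {p : ℕ} (hp : 1 < p) (n : ℕ) :
    |(volterraCoeff p n).1| + |(volterraCoeff p n).2| ≤
      (2 * powGeomSum 2 (1 / 2) * (1 + Real.log p)) ^ n *
        (p : ℝ) ^ (-((n : ℝ) * ((n : ℝ) - 1) / 2)) := by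
  have hp2 : (2 : ℝ) ≤ p := mod_cast hp
  have hp0 : (0 : ℝ) < p := by linarith
  have hL : 0 ≤ Real.log p := Real.log_nonneg (by linarith)
  have hD : 0 ≤ powGeomSum 2 (1 / 2) := powGeomSum_nonneg 2 (by norm_num)
  induction n with
  | zero => simp [volterraCoeff]
  | succ n ih =>
    simp only [volterraCoeff]
    set a := (volterraCoeff p n).1
    set b := (volterraCoeff p n).2
    set Q : ℝ := ((p : ℝ) ^ (n + 1))⁻¹ with hQ
    have hQ0 : 0 ≤ Q := by positivity
    have hQp : Q ≤ ((p : ℝ) ^ n)⁻¹ := by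
      rw [hQ]
      gcongr
      · linarith
      · omega
    have hQ1 : Q ≤ 1 / 2 := by
      rw [hQ, one_div]
      gcongr
      calc (2 : ℝ) ≤ p := hp2
        _ ≤ (p : ℝ) ^ (n + 1) := le_self_pow₀ (by linarith) (by omega)
    set s := powGeomSum 1 Q
    set t := powGeomSum 2 Q
    have hs : 0 ≤ s := powGeomSum_nonneg 1 hQ0
    have hst : s ≤ t := powGeomSum_one_le_two hQ0 (by linarith)
    have ht : t ≤ 2 * powGeomSum 2 (1 / 2) * Q := powGeomSum_le 2 hQ0 hQ1
    have hc : |-(1 - (p : ℝ)⁻¹) ^ 2| ≤ 1 := by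
      have h1 : (p : ℝ)⁻¹ ≤ 1 := inv_le_one_of_one_le₀ (by linarith)
      have h2 : 0 < (p : ℝ)⁻¹ := by positivity
      rw [abs_neg, abs_of_nonneg (sq_nonneg _)]
      exact pow_le_one₀ (by linarith) (by linarith)
    have h1 : |-(1 - (p : ℝ)⁻¹) ^ 2 * (s * a)| ≤ t * |a| := by
      rw [abs_mul, abs_mul s, abs_of_nonneg hs]
      exact (mul_le_of_le_one_left (by positivity) hc).trans (by gcongr)
    have h2 : |-(1 - (p : ℝ)⁻¹) ^ 2 * (s * b - Real.log p * t * a)|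
        ≤ t * |b| + Real.log p * t * |a| := by
      rw [abs_mul]
      refine (mul_le_of_le_one_left (by positivity) hc).trans ((abs_sub _ _).trans ?_)
      rw [abs_mul, abs_mul, abs_of_nonneg hs, abs_of_nonneg (mul_nonneg hL (hs.trans hst))]
      gcongr
    have hexp : (p : ℝ) ^ (-((n : ℝ) * ((n : ℝ) - 1) / 2)) * ((p : ℝ) ^ n)⁻¹
        = (p : ℝ) ^ (-(((n + 1 : ℕ) : ℝ) * (((n + 1 : ℕ) : ℝ) - 1) / 2)) := by
      rw [← Real.rpow_natCast, ← Real.rpow_neg hp0.le, ← Real.rpow_add hp0]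
      congr 1
      push_cast
      ring
    calc |-(1 - (p : ℝ)⁻¹) ^ 2 * (s * a)|
          + |-(1 - (p : ℝ)⁻¹) ^ 2 * (s * b - Real.log p * t * a)|
        ≤ t * |a| + (t * |b| + Real.log p * t * |a|) := add_le_add h1 h2
      _ ≤ t * |a| + (t * |b| + Real.log p * t * |a|) + Real.log p * t * |b| :=
        le_add_of_nonneg_right (mul_nonneg (mul_nonneg hL (hs.trans hst)) (abs_nonneg b))
      _ = t * (1 + Real.log p) * (|a| + |b|) := by ring
      _ ≤ 2 * powGeomSum 2 (1 / 2) * ((p : ℝ) ^ n)⁻¹ * (1 + Real.log p) *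
          ((2 * powGeomSum 2 (1 / 2) * (1 + Real.log p)) ^ n *
            (p : ℝ) ^ (-((n : ℝ) * ((n : ℝ) - 1) / 2))) := by
        gcongr
        exact ht.trans (by gcongr)
      _ = _ := by
        rw [← hexp]
        ring

end Series

noncomputable section

variable (p : ℕ) [Fact p.Prime] [MeasurableSpace ℚ_[p]] [BorelSpace ℚ_[p]]

section Measure

variable {p}

theorem measurableSet_norm_le (r : ℝ) : MeasurableSet {x : ℚ_[p] | ‖x‖ ≤ r} :=
  measurableSet_le measurable_norm measurable_const

theorem measurableSet_norm_eq (r : ℝ) : MeasurableSet {x : ℚ_[p] | ‖x‖ = r} :=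
  measurableSet_eq_fun measurable_norm measurable_const

variable (μ : Measure ℚ_[p]) [μ.IsAddHaarMeasure]

theorem measure_norm_le_zpow_add_one (m : ℤ) :
    μ {x | ‖x‖ ≤ (p : ℝ) ^ (m + 1)} = p * μ {x | ‖x‖ ≤ (p : ℝ) ^ m} := by
  have hp : (1 : ℝ) ≤ p := mod_cast (Fact.out : p.Prime).one_le
  have e : {x : ℚ_[p] | ‖x‖ ≤ (p : ℝ) ^ (m + 1)} = ⋃ a ∈ Finset.range p,
      (fun x => x + -((a : ℚ_[p]) * (p : ℚ_[p]) ^ (-(m + 1)))) ⁻¹' {x | ‖x‖ ≤ (p : ℝ) ^ m} := by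
    ext x
    simp only [Set.mem_ofPred_eq, Finset.mem_range, Set.mem_iUnion, Set.mem_preimage,
      ← sub_eq_add_neg, exists_prop]
    refine ⟨Padic.exists_lt_norm_sub_natCast_mul_le m x, fun ⟨a, _, ha⟩ => ?_⟩
    have h : ‖(a : ℚ_[p]) * (p : ℚ_[p]) ^ (-(m + 1))‖ ≤ (p : ℝ) ^ (m + 1) := by
      rw [norm_mul, Padic.norm_p_zpow, neg_neg]
      exact mul_le_of_le_one_left (by positivity) (mod_cast Padic.norm_int_le_one (a : ℤ))
    have h2 : (p : ℝ) ^ m ≤ (p : ℝ) ^ (m + 1) := zpow_le_zpow_right₀ hp (by omega)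
    simpa using (Padic.nonarchimedean (x - (a : ℚ_[p]) * (p : ℚ_[p]) ^ (-(m + 1))) _).trans
      (max_le (ha.trans h2) h)
  rw [e, measure_biUnion_finset]
  · simp_rw [measure_preimage_add_right]
    simp
  · intro a ha b hb hab
    simp only [Finset.coe_range, Set.mem_Iio] at ha hb
    refine Set.disjoint_left.2 fun x hxa hxb => hab ?_
    simp only [Set.mem_preimage, Set.mem_ofPred_eq, ← sub_eq_add_neg] at hxa hxb
    exact Padic.natCast_eq_of_norm_sub_mul_le m x ha hb hxa hxb
  · exact fun a _ => (measurable_add_const _) (measurableSet_norm_le _)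

variable {μ}

theorem measureReal_norm_le_zpow (hμ : μ {x : ℚ_[p] | ‖x‖ ≤ 1} = 1)
    (m : ℤ) : μ.real {x | ‖x‖ ≤ (p : ℝ) ^ m} = (p : ℝ) ^ m := by
  have hp : (p : ℝ) ≠ 0 := mod_cast (Fact.out : p.Prime).ne_zero
  have step (m : ℤ) : μ.real {x | ‖x‖ ≤ (p : ℝ) ^ (m + 1)}
      = p * μ.real {x | ‖x‖ ≤ (p : ℝ) ^ m} := by
    simp [measureReal_def, measure_norm_le_zpow_add_one]
  induction m with
  | zero => simp [measureReal_def, hμ]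
  | succ n ih => rw [step, ih, zpow_add_one₀ hp, mul_comm]
  | pred n ih =>
    have h := step (-n - 1)
    rw [sub_add_cancel, ih] at h
    refine mul_left_cancel₀ hp (h.symm.trans ?_)
    rw [zpow_sub_one₀ hp]
    field_simp

theorem measureReal_norm_eq_zpow (hμ : μ {x : ℚ_[p] | ‖x‖ ≤ 1} = 1)
    (m : ℤ) :
    μ.real {x | ‖x‖ = (p : ℝ) ^ m} = (p : ℝ) ^ m * (1 - (p : ℝ)⁻¹) := by
  have hp : (1 : ℝ) < p := mod_cast (Fact.out : p.Prime).one_lt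
  have e : {x : ℚ_[p] | ‖x‖ = (p : ℝ) ^ m}
      = {x | ‖x‖ ≤ (p : ℝ) ^ m} \ {x | ‖x‖ ≤ (p : ℝ) ^ (m - 1)} := by
    ext x
    simp only [Set.mem_ofPred_eq, Set.mem_sdiff, Padic.norm_le_pow_iff_norm_lt_pow_add_one x (m - 1),
      sub_add_cancel, not_lt]
    exact le_antisymm_iff
  have hle : (p : ℝ) ^ (m - 1) ≤ (p : ℝ) ^ m := zpow_le_zpow_right₀ hp.le (by omega)
  have hsub : {x : ℚ_[p] | ‖x‖ ≤ (p : ℝ) ^ (m - 1)} ⊆ {x | ‖x‖ ≤ (p : ℝ) ^ m} :=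
    fun x hx => le_trans hx hle
  have hfin : μ {x | ‖x‖ ≤ (p : ℝ) ^ m} ≠ ⊤ := fun h => by
    have h' := measureReal_norm_le_zpow hμ m
    rw [measureReal_def, h] at h'
    exact (zpow_pos (by linarith : (0 : ℝ) < p) m).ne h'
  rw [e, measureReal_sdiff hsub (measurableSet_norm_le _) hfin,
    measureReal_norm_le_zpow hμ, measureReal_norm_le_zpow hμ, zpow_sub_one₀ (by linarith)]
  ring

theorem hasSum_setIntegral_norm_lt_zpow (hμ : μ {x : ℚ_[p] | ‖x‖ ≤ 1} = 1)
    (m : ℤ) (F : ℝ → ℂ)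
    (hF : Summable fun k : ℕ => (p : ℝ) ^ (m - (k + 1)) * ‖F ((p : ℝ) ^ (m - (k + 1)))‖) :
    HasSum (fun k : ℕ => (((p : ℝ) ^ (m - (k + 1)) * (1 - (p : ℝ)⁻¹) : ℝ) : ℂ) *
      F ((p : ℝ) ^ (m - (k + 1)))) (∫ y in {y : ℚ_[p] | ‖y‖ < (p : ℝ) ^ m}, F ‖y‖ ∂μ) := by
  have hp : (1 : ℝ) < p := mod_cast (Fact.out : p.Prime).one_lt
  let S (k : ℕ) : Set ℚ_[p] := {y | ‖y‖ = (p : ℝ) ^ (m - (k + 1))}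
  have hS (k : ℕ) : MeasurableSet (S k) := measurableSet_norm_eq _
  have hdisj : Pairwise (Function.onFun Disjoint S) := fun i j hij =>
    Set.disjoint_left.2 fun x hi hj => hij <| by
      have := zpow_right_injective₀ (by linarith) hp.ne' (hi.symm.trans hj)
      omega
  have hU : {y : ℚ_[p] | ‖y‖ < (p : ℝ) ^ m} =ᵐ[μ] ⋃ k, S k := by
    have h0 : ∀ᵐ y ∂μ, y ≠ 0 := by simp [ae_iff]
    filter_upwards [h0] with y hy
    refine propext ?_
    change ‖y‖ < (p : ℝ) ^ m ↔ y ∈ ⋃ k, S k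
    simp only [Set.mem_iUnion, S, Set.mem_ofPred_eq]
    rw [Padic.norm_eq_zpow_neg_valuation hy, zpow_lt_zpow_iff_right₀ hp]
    refine ⟨fun h => ⟨(m + y.valuation - 1).toNat, ?_⟩, fun ⟨k, hk⟩ => ?_⟩
    · congr 1
      omega
    · have := zpow_right_injective₀ (by linarith) hp.ne' hk
      omega
  have hfin (k : ℕ) : μ (S k) ≠ ⊤ := fun h => by
    have h' := measureReal_norm_eq_zpow hμ (m - (k + 1))
    rw [measureReal_def, h] at h'
    have : 0 < (p : ℝ) ^ (m - (k + 1)) * (1 - (p : ℝ)⁻¹) :=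
      mul_pos (zpow_pos (by linarith) _) (by linarith [inv_lt_one_of_one_lt₀ hp])
    exact this.ne h'
  have hint (k : ℕ) : IntegrableOn (fun y => F ‖y‖) (S k) μ :=
    (integrableOn_const (hfin k) (C := F ((p : ℝ) ^ (m - (k + 1))))).congr_fun
      (fun y hy => by simp only [S, Set.mem_ofPred_eq] at hy; simp [hy]) (hS k)
  have hval {E : Type} [NormedAddCommGroup E] [NormedSpace ℝ E] [CompleteSpace E]
      (G : ℝ → E) (k : ℕ) :
      ∫ y in S k, G ‖y‖ ∂μ
        = ((p : ℝ) ^ (m - (k + 1)) * (1 - (p : ℝ)⁻¹)) • G ((p : ℝ) ^ (m - (k + 1))) := by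
    rw [setIntegral_congr_fun (g := fun _ => G ((p : ℝ) ^ (m - (k + 1)))) (hS k)
      (fun y hy => by simp only [S, Set.mem_ofPred_eq] at hy; simp [hy]), setIntegral_const,
      measureReal_norm_eq_zpow hμ]
  rw [setIntegral_congr_set hU]
  convert! hasSum_integral_iUnion hS hdisj
    (integrableOn_iUnion_of_summable_integral_norm hint ?_) using 1
  · funext k
    rw [hval, Complex.real_smul]
  · simp_rw [hval (fun r => ‖F r‖), smul_eq_mul, mul_right_comm]
    exact hF.mul_right _

theorem Ivol_apply_of_eq_pow_mul_log (hμ : μ {x : ℚ_[p] | ‖x‖ ≤ 1} = 1)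
    {f : ℚ_[p] → ℂ} {A B : ℝ} {n : ℕ}
    (hf : ∀ y ≠ 0, f y = ((A * ‖y‖ ^ n * Real.log ‖y‖ + B * ‖y‖ ^ n : ℝ) : ℂ))
    {x : ℚ_[p]} (hx : x ≠ 0) :
    Ivol p μ f x =
      ((-(1 - (p : ℝ)⁻¹) ^ 2 * (powGeomSum 1 ((p : ℝ) ^ (n + 1))⁻¹ * A)
          * ‖x‖ ^ (n + 1) * Real.log ‖x‖
        + -(1 - (p : ℝ)⁻¹) ^ 2 * (powGeomSum 1 ((p : ℝ) ^ (n + 1))⁻¹ * B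
          - Real.log p * powGeomSum 2 ((p : ℝ) ^ (n + 1))⁻¹ * A) * ‖x‖ ^ (n + 1) : ℝ) : ℂ) := by
  have hp : (1 : ℝ) < p := mod_cast (Fact.out : p.Prime).one_lt
  have hp0 : (0 : ℝ) < p := by linarith
  have hL : Real.log p ≠ 0 := (Real.log_pos hp).ne'
  have hP : 1 - (p : ℝ)⁻¹ ≠ 0 := by linarith [inv_lt_one_of_one_lt₀ hp]
  obtain ⟨m, hm⟩ : ∃ m : ℤ, ‖x‖ = (p : ℝ) ^ m := ⟨_, Padic.norm_eq_zpow_neg_valuation hx⟩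
  have hr : 0 < ‖x‖ := norm_pos_iff.2 hx
  set Q : ℝ := ((p : ℝ) ^ (n + 1))⁻¹ with hQ
  have hQ0 : 0 ≤ Q := by positivity
  have hQ1 : Q < 1 := inv_lt_one_of_one_lt₀ (one_lt_pow₀ hp (by omega))
  let g (s : ℝ) : ℝ := (Real.log ‖x‖ - Real.log s) * (A * s ^ n * Real.log s + B * s ^ n)
  have hs (k : ℕ) : (p : ℝ) ^ (m - (k + 1)) = ‖x‖ * (p : ℝ)⁻¹ ^ (k + 1) := by
    rw [hm, zpow_sub₀ hp0.ne', inv_pow, div_eq_mul_inv]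
    norm_cast
  have hlog (k : ℕ) : Real.log ((p : ℝ) ^ (m - (k + 1)))
      = Real.log ‖x‖ - (k + 1) * Real.log p := by
    rw [hm, Real.log_zpow, Real.log_zpow]
    push_cast
    ring
  have hterm (k : ℕ) : (p : ℝ) ^ (m - (k + 1)) * g ((p : ℝ) ^ (m - (k + 1)))
      = ‖x‖ ^ (n + 1) * Real.log p *
        ((A * Real.log ‖x‖ + B) * (((k : ℝ) + 1) ^ 1 * Q ^ (k + 1))
          - A * Real.log p * (((k : ℝ) + 1) ^ 2 * Q ^ (k + 1))) := by
    have hQk : Q ^ (k + 1) = ((p : ℝ)⁻¹ ^ (k + 1)) ^ n * (p : ℝ)⁻¹ ^ (k + 1) := by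
      rw [hQ, ← inv_pow]
      ring
    simp only [g, hlog]
    rw [hs, hQk]
    ring
  have hsum : HasSum (fun k : ℕ => (p : ℝ) ^ (m - (k + 1)) * g ((p : ℝ) ^ (m - (k + 1))))
      (‖x‖ ^ (n + 1) * Real.log p *
        ((A * Real.log ‖x‖ + B) * powGeomSum 1 Q - A * Real.log p * powGeomSum 2 Q)) := by
    simp_rw [hterm]
    exact (((hasSum_powGeomSum 1 hQ0 hQ1).mul_left _).sub
      ((hasSum_powGeomSum 2 hQ0 hQ1).mul_left _)).mul_left _
  have hI := hasSum_setIntegral_norm_lt_zpow hμ m (fun s => (g s : ℂ)) <| by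
    refine hsum.summable.abs.congr fun k => ?_
    rw [abs_mul, abs_of_pos (zpow_pos hp0 _), Complex.norm_real, Real.norm_eq_abs]
  have hI' := hI.unique <| by
    convert! Complex.hasSum_ofReal.2 (hsum.mul_right (1 - (p : ℝ)⁻¹)) using 2 with k
    push_cast
    ring
  have hcongr : ∫ y in {y : ℚ_[p] | ‖y‖ < ‖x‖},
        ((Real.log ‖x‖ - Real.log ‖y‖ : ℝ) : ℂ) * f y ∂μ
      = ∫ y in {y : ℚ_[p] | ‖y‖ < (p : ℝ) ^ m}, (g ‖y‖ : ℂ) ∂μ := by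
    rw [← hm]
    refine integral_congr_ae (ae_restrict_of_ae ?_)
    have h0 : ∀ᵐ y ∂μ, y ≠ 0 := by simp [ae_iff]
    filter_upwards [h0] with y hy
    rw [hf y hy, ← Complex.ofReal_mul]
  rw [Ivol, hcongr, hI', ← Complex.ofReal_mul]
  congr 1
  field_simp
  ring

theorem Ivol_iterate_log (hμ : μ {x : ℚ_[p] | ‖x‖ ≤ 1} = 1)
    (n : ℕ) {x : ℚ_[p]} (hx : x ≠ 0) :
    (Ivol p μ)^[n] (fun y => ((Real.log ‖y‖ : ℝ) : ℂ)) x =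
      (((volterraCoeff p n).1 * ‖x‖ ^ n * Real.log ‖x‖
        + (volterraCoeff p n).2 * ‖x‖ ^ n : ℝ) : ℂ) := by
  induction n generalizing x with
  | zero => simp [volterraCoeff]
  | succ n ih =>
    rw [Function.iterate_succ_apply']
    exact Ivol_apply_of_eq_pow_mul_log hμ (fun y hy => ih hy) hx

end Measure

/-- There are constants `C > 0` and coefficients `σ_n, η_n` with
`|σ_n|, |η_n| ≤ Cⁿ p^{-n(n−1)/2}` such that for every `n ≥ 1` and every `x ∈ ℤ_p`, `x ≠ 0`,
`(Ĩⁿ log‖·‖)(x) = σ_n ‖x‖ⁿ log‖x‖ + η_n ‖x‖ⁿ`. -/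
theorem statement13
    (μ : Measure ℚ_[p]) [μ.IsAddHaarMeasure]
    (hμ : μ {x : ℚ_[p] | ‖x‖ ≤ 1} = 1) :
    ∃ C : ℝ, 0 < C ∧ ∃ σ η : ℕ → ℂ,
      (∀ n : ℕ, 1 ≤ n →
        ‖σ n‖ ≤ C ^ n * (p : ℝ) ^ (-((n : ℝ) * ((n : ℝ) - 1) / 2)) ∧
        ‖η n‖ ≤ C ^ n * (p : ℝ) ^ (-((n : ℝ) * ((n : ℝ) - 1) / 2))) ∧
      (∀ n : ℕ, 1 ≤ n → ∀ x : ℚ_[p], ‖x‖ ≤ 1 → x ≠ 0 →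
        (Ivol p μ)^[n] (fun y => ((Real.log ‖y‖ : ℝ) : ℂ)) x
          = σ n * ((‖x‖ ^ n : ℝ) : ℂ) * ((Real.log ‖x‖ : ℝ) : ℂ)
            + η n * ((‖x‖ ^ n : ℝ) : ℂ)) := by
  have hp : 1 < p := (Fact.out : p.Prime).one_lt
  have hC : 0 ≤ 2 * powGeomSum 2 (1 / 2) * (1 + Real.log p) := by
    have := powGeomSum_nonneg 2 (Q := 1 / 2) (by norm_num)
    have := Real.log_nonneg (x := p) (mod_cast hp.le)
    positivity
  have hbound (n : ℕ) : |(volterraCoeff p n).1| + |(volterraCoeff p n).2| ≤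
      (2 * powGeomSum 2 (1 / 2) * (1 + Real.log p) + 1) ^ n *
        (p : ℝ) ^ (-((n : ℝ) * ((n : ℝ) - 1) / 2)) :=
    (volterraCoeff_bound hp n).trans (by gcongr; linarith)
  refine ⟨2 * powGeomSum 2 (1 / 2) * (1 + Real.log p) + 1, by linarith,
    fun n => (volterraCoeff p n).1, fun n => (volterraCoeff p n).2, fun n _ => ?_,
    fun n _ x _ hx => ?_⟩
  · simp only [Complex.norm_real, Real.norm_eq_abs]
    exact ⟨(le_add_of_nonneg_right (abs_nonneg _)).trans (hbound n),
      (le_add_of_nonneg_left (abs_nonneg _)).trans (hbound n)⟩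
  · rw [Ivol_iterate_log hμ n hx]
    push_cast
    ring
end
end
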